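/- Let P be a finite nonempty subset of a metric space M, let k, ℓ be integers with 1 ≤ ℓ ≤ k ≤ |P|, let q_1, …, q_m (m ≥ 2) be a Gonzalez sequence in P, and let C ⊆ P be such that for every i, C contains at least ℓ points of P each within distance dist_ℓ(P, q_i) of q_i. Let C* ⊆ P with |C*| = k be an optimal fault-tolerant k-center solution, so r_opt = max_{p ∈ P} dist_ℓ(C*, p) is the optimal cost, and let r_alg = max_{p ∈ P} dist_ℓ(C, p). If r_alg > 3·r_opt, then for all 1 ≤ i ≠ j ≤ m the closed balls B(q_i, r_opt) and B(q_j, r_opt) are disjoint, and each ball B(q_i, r_opt) contains at least ℓ points of C*. -/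

import Mathlib

/-- `kthDist S p i` is the `i`-th smallest value (1-indexed) among the distances
`dist p s` for `s ∈ S`, i.e. the radius of the smallest closed ball centered at `p`
containing at least `i` points of `S`. -/
noncomputable def kthDist {M : Type*} [MetricSpace M] (S : Finset M) (p : M) (i : ℕ) : ℝ :=
  ((S.val.map (fun s => dist p s)).sort (· ≤ ·)).getD (i - 1) 0

theorem List.getD_le_iff_lt_countP {L : List ℝ} (hL : L.Pairwise (· ≤ ·)) {i : ℕ}
    (hi : i < L.length) (r : ℝ) : L.getD i 0 ≤ r ↔ i < L.countP (fun x => x ≤ r) := by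
  induction L generalizing i with
  | nil => simp at hi
  | cons a t ih =>
    rw [List.pairwise_cons] at hL
    by_cases har : a ≤ r
    · cases i with
      | zero => simp [har]
      | succ i =>
        have h := ih hL.2 (by simpa using hi : i < t.length)
        simpa [har] using h
    · have h0 : t.countP (fun x => x ≤ r) = 0 := by
        rw [List.countP_eq_zero]
        intro x hx
        have := hL.1 x hx
        simp only [decide_eq_true_eq]
        linarith
      cases i with
      | zero => simp [har, h0]
      | succ i =>
        have hi' : i < t.length := by simpa using hi
        have h := ih hL.2 hi'
        simp only [h0, List.countP_cons, har] at h ⊢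
        simpa using h

theorem kthDist_le_iff {M : Type*} [MetricSpace M] (S : Finset M) (p : M) {i : ℕ}
    (h1 : 1 ≤ i) (hi : i ≤ S.card) (r : ℝ) :
    kthDist S p i ≤ r ↔ i ≤ (S.filter (fun x => dist p x ≤ r)).card := by
  unfold kthDist
  rw [List.getD_le_iff_lt_countP (Multiset.pairwise_sort _ _) (by simp; omega)]
  have h : ((S.val.map (fun s => dist p s)).sort (· ≤ ·)).countP (fun x => x ≤ r)
      = (S.filter (fun x => dist p x ≤ r)).card := by
    rw [← Multiset.coe_countP, Multiset.sort_eq, Multiset.countP_map]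
    rfl
  rw [h]
  omega

/-- Let `P` be a finite nonempty subset of a metric space,
`1 ≤ ℓ ≤ k ≤ |P|`, let `q 1, …, q m` (`m ≥ 2`) be a Gonzalez sequence in `P`, and let
`C ⊆ P` be such that for every `i`, `C` contains at least `ℓ` points of `P` each within
distance `dist_ℓ(P, q i)` of `q i`.  Let `C* ⊆ P` with `|C*| = k` be an optimal
fault-tolerant `k`-center solution, so `r_opt = max_{p ∈ P} dist_ℓ(C*, p)` is the optimal
cost, and let `r_alg = max_{p ∈ P} dist_ℓ(C, p)`.  If `r_alg > 3·r_opt`, then for all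
`1 ≤ i ≠ j ≤ m` the closed balls `B(q i, r_opt)` and `B(q j, r_opt)` are disjoint, and
each ball `B(q i, r_opt)` contains at least `ℓ` points of `C*`. -/
theorem gonzalez_balls_disjoint_of_large_ralg {M : Type*} [MetricSpace M] [DecidableEq M]
    (P : Finset M) (hP : P.Nonempty) (k ℓ : ℕ)
    (hl1 : 1 ≤ ℓ) (hlk : ℓ ≤ k) (hkP : k ≤ P.card)
    (m : ℕ) (hm : 2 ≤ m)
    (q : ℕ → M) (hq1 : q 1 ∈ P)
    (hgonz : ∀ i, 2 ≤ i → i ≤ m → q i ∈ P ∧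
      ∀ p ∈ P, Metric.infDist p (((Finset.Icc 1 (i - 1)).image q : Finset M) : Set M) ≤
        Metric.infDist (q i) (((Finset.Icc 1 (i - 1)).image q : Finset M) : Set M))
    (C : Finset M) (hCP : C ⊆ P)
    (hC : ∀ i, 1 ≤ i → i ≤ m →
      ℓ ≤ (C.filter (fun x => dist (q i) x ≤ kthDist P (q i) ℓ)).card)
    (Cstar : Finset M) (hCsP : Cstar ⊆ P) (hCscard : Cstar.card = k)
    (ropt : ℝ) (hropt : ropt = P.sup' hP (fun p => kthDist Cstar p ℓ))
    (hCsOpt : ∀ C' : Finset M, C' ⊆ P → C'.card = k →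
      ropt ≤ P.sup' hP (fun p => kthDist C' p ℓ))
    (ralg : ℝ) (hralg : ralg = P.sup' hP (fun p => kthDist C p ℓ))
    (hbig : 3 * ropt < ralg) :
    (∀ i j, 1 ≤ i → i ≤ m → 1 ≤ j → j ≤ m → i ≠ j →
      Disjoint (Metric.closedBall (q i) ropt) (Metric.closedBall (q j) ropt)) ∧
    (∀ i, 1 ≤ i → i ≤ m → ℓ ≤ (Cstar.filter (fun x => dist (q i) x ≤ ropt)).card) := by
  have hqP : ∀ i, 1 ≤ i → i ≤ m → q i ∈ P := by
    intro i h1 h2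
    rcases h1.eq_or_lt with rfl | h
    · exact hq1
    · exact (hgonz i h h2).1
  have hstar : ∀ i, 1 ≤ i → i ≤ m →
      ℓ ≤ (Cstar.filter (fun x => dist (q i) x ≤ ropt)).card := by
    intro i h1 h2
    rw [← kthDist_le_iff Cstar (q i) hl1 (by omega), hropt]
    exact Finset.le_sup' (fun p => kthDist Cstar p ℓ) (hqP i h1 h2)
  obtain ⟨p, hpP, hp⟩ := Finset.exists_mem_eq_sup' hP (fun p => kthDist C p ℓ)
  have hCcard : ℓ ≤ C.card :=
    (hC 1 le_rfl (by omega)).trans (Finset.card_le_card (Finset.filter_subset _ _))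
  have hfar : ∀ i, 1 ≤ i → i ≤ m → 2 * ropt < dist p (q i) := by
    intro i h1 h2
    by_contra! hle
    have hPr : kthDist P (q i) ℓ ≤ ropt := by
      rw [kthDist_le_iff P (q i) hl1 (by omega)]
      exact (hstar i h1 h2).trans
        (Finset.card_le_card (Finset.filter_subset_filter _ hCsP))
    have hCr : kthDist C p ℓ ≤ 3 * ropt := by
      rw [kthDist_le_iff C p hl1 hCcard]
      refine (hC i h1 h2).trans (Finset.card_le_card ?_)
      intro x hx
      rw [Finset.mem_filter] at hx ⊢
      refine ⟨hx.1, ?_⟩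
      linarith [dist_triangle p (q i) x, hx.2]
    linarith
  have hsep : ∀ i j, 1 ≤ i → i < j → j ≤ m → 2 * ropt < dist (q j) (q i) := by
    intro i j h1 hij hjm
    have hi : q i ∈ (Finset.Icc 1 (j - 1)).image q :=
      Finset.mem_image_of_mem q (by rw [Finset.mem_Icc]; omega)
    have hg := (hgonz j (by omega) hjm).2 p hpP
    obtain ⟨y, hy, hyd⟩ := (Finset.finite_toSet ((Finset.Icc 1 (j - 1)).image q)).isCompact
      |>.exists_infDist_eq_dist ⟨q i, hi⟩ p
    obtain ⟨n, hn, rfl⟩ := Finset.mem_image.mp (Finset.mem_coe.mp hy)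
    rw [Finset.mem_Icc] at hn
    have hle := Metric.infDist_le_dist_of_mem (x := q j) (Finset.mem_coe.mpr hi)
    linarith [hfar n hn.1 (by omega)]
  refine ⟨fun i j hi him hj hjm hij => ?_, hstar⟩
  apply Metric.closedBall_disjoint_closedBall
  rcases hij.lt_or_gt with h | h
  · linarith [hsep i j hi h hjm, dist_comm (q i) (q j)]
  · linarith [hsep j i hj h him]
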